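/- Let (a_k)_{k≥1} satisfy Σ_{k=1}^∞ |a_k| < ∞ and let n ≥ 3 be an integer. Set q_n(x) = n² Σ_{k=1}^∞ a_k e^{iknx}. Then the Floquet discriminant of q_n at spectral parameter 1 satisfies Δ(q_n; 1) = 2. -/

import Mathlib

noncomputable section

/-- `ψ` is a (twice differentiable) solution of the Hill equation `-ψ'' + q ψ = z ψ` on `ℝ`. -/
def IsHillSolution (q : ℝ → ℂ) (z : ℂ) (ψ : ℝ → ℂ) : Prop :=
  Differentiable ℝ ψ ∧ Differentiable ℝ (deriv ψ) ∧
    ∀ x : ℝ, -deriv (deriv ψ) x + q x * ψ x = z * ψ x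

/-- Coefficients `c` of the formal solution `∑ c m * exp (I * (1 + n * m) * x)` of the Hill equation
at spectral parameter `1`, normalised by `c 0 = 1`. -/
def floquetCoeff (a : ℕ → ℂ) (n : ℕ) : ℕ → ℂ
  | 0 => 1
  | m + 1 => -((n : ℂ) ^ 2 / ((1 + n * ((m : ℂ) + 1)) ^ 2 - 1)) *
      ∑ j : Fin (m + 1), floquetCoeff a n j * a (m - j)

lemma norm_div_sq_sub_one_le {n : ℕ} (hn : 0 < n) (m : ℕ) :
    ‖(n : ℂ) ^ 2 / ((1 + n * ((m : ℂ) + 1)) ^ 2 - 1)‖ ≤ 1 / ((m : ℝ) + 1) ^ 2 := by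
  have hcast : (n : ℂ) ^ 2 / ((1 + n * ((m : ℂ) + 1)) ^ 2 - 1) =
      (((n : ℝ) ^ 2 / ((1 + n * ((m : ℝ) + 1)) ^ 2 - 1) : ℝ) : ℂ) := by
    push_cast; rfl
  have hn' : (0 : ℝ) < n := by exact_mod_cast hn
  have hm : (0 : ℝ) < (m : ℝ) + 1 := by positivity
  have hp : 0 < (n : ℝ) * ((m : ℝ) + 1) := by positivity
  have hd : 0 < (1 + n * ((m : ℝ) + 1)) ^ 2 - 1 := by nlinarith
  rw [hcast, Complex.norm_real, Real.norm_of_nonneg (by positivity),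
    div_le_div_iff₀ hd (by positivity)]
  nlinarith

lemma one_add_mul_sq_sub_one_ne_zero {n : ℕ} (hn : 0 < n) (m : ℕ) :
    (1 + n * ((m : ℂ) + 1)) ^ 2 - 1 ≠ 0 := by
  have h : (1 + n * ((m : ℂ) + 1)) ^ 2 - 1 = ((n * (m + 1) * (n * (m + 1) + 2) : ℕ) : ℂ) := by
    push_cast; ring
  rw [h, Nat.cast_ne_zero]
  positivity

lemma floquetCoeff_succ (a : ℕ → ℂ) (n m : ℕ) :
    floquetCoeff a n (m + 1) = -((n : ℂ) ^ 2 / ((1 + n * ((m : ℂ) + 1)) ^ 2 - 1)) *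
      ∑ p ∈ Finset.HasAntidiagonal.antidiagonal m, floquetCoeff a n p.1 * a p.2 := by
  rw [floquetCoeff, Finset.Nat.sum_antidiagonal_eq_sum_range_succ
    (fun i j => floquetCoeff a n i * a j), Finset.sum_range]

lemma floquetCoeff_recurrence (a : ℕ → ℂ) {n : ℕ} (hn : 0 < n) (m : ℕ) :
    ((1 + n * ((m : ℂ) + 1)) ^ 2 - 1) * floquetCoeff a n (m + 1) =
      -((n : ℂ) ^ 2 * ∑ p ∈ Finset.HasAntidiagonal.antidiagonal m, floquetCoeff a n p.1 * a p.2) := by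
  have := one_add_mul_sq_sub_one_ne_zero hn m
  rw [floquetCoeff_succ]
  field_simp

lemma norm_floquetCoeff_succ_le {a : ℕ → ℂ} (ha : Summable fun k => ‖a k‖) {n : ℕ} (hn : 0 < n)
    {m : ℕ} {B : ℝ} (hB : ∀ j ≤ m, ‖floquetCoeff a n j‖ ≤ B) :
    ‖floquetCoeff a n (m + 1)‖ ≤ 1 / ((m : ℝ) + 1) ^ 2 * (B * ∑' k, ‖a k‖) := by
  have hB0 : 0 ≤ B := (norm_nonneg _).trans (hB 0 (Nat.zero_le _))
  rw [floquetCoeff_succ, norm_mul, norm_neg]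
  refine mul_le_mul (norm_div_sq_sub_one_le hn m) ?_ (norm_nonneg _) (by positivity)
  calc ‖∑ p ∈ Finset.HasAntidiagonal.antidiagonal m, floquetCoeff a n p.1 * a p.2‖
      ≤ ∑ p ∈ Finset.HasAntidiagonal.antidiagonal m, B * ‖a p.2‖ := by
        refine norm_sum_le_of_le _ fun p hp => ?_
        rw [norm_mul]
        have := hB p.1 (by have := Finset.HasAntidiagonal.mem_antidiagonal.1 hp; omega)
        gcongr
    _ = B * ∑ j ∈ Finset.range (m + 1), ‖a j‖ := by
        rw [← Finset.mul_sum, ← Finset.Nat.sum_antidiagonal_swap,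
          Finset.Nat.sum_antidiagonal_eq_sum_range_succ_mk]
        rfl
    _ ≤ B * ∑' k, ‖a k‖ := by
        gcongr
        exact ha.sum_le_tsum _ fun _ _ => norm_nonneg _

lemma exists_norm_floquetCoeff_le {a : ℕ → ℂ} (ha : Summable fun k => ‖a k‖) {n : ℕ}
    (hn : 0 < n) : ∃ B, ∀ m, ‖floquetCoeff a n m‖ ≤ B := by
  obtain ⟨N, hN⟩ := exists_nat_ge (∑' k, ‖a k‖)
  refine ⟨∑ j ∈ Finset.range (N + 1), ‖floquetCoeff a n j‖, fun m => ?_⟩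
  set B := ∑ j ∈ Finset.range (N + 1), ‖floquetCoeff a n j‖
  have hB0 : 0 ≤ B := Finset.sum_nonneg fun _ _ => norm_nonneg _
  induction m using Nat.strong_induction_on with
  | _ m ih =>
    rcases Nat.lt_or_ge m (N + 1) with h | h
    · exact Finset.single_le_sum (f := fun j => ‖floquetCoeff a n j‖)
        (fun _ _ => norm_nonneg _) (Finset.mem_range.2 h)
    · obtain ⟨m, rfl⟩ : ∃ k, m = k + 1 := ⟨m - 1, by omega⟩
      refine (norm_floquetCoeff_succ_le ha hn fun j hj => ih j (by omega)).trans ?_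
      have hNm : (N : ℝ) ≤ m := by exact_mod_cast (by omega : N ≤ m)
      rw [one_div_mul_eq_div, div_le_iff₀ (by positivity)]
      gcongr
      nlinarith

lemma summable_norm_floquetCoeff {a : ℕ → ℂ} (ha : Summable fun k => ‖a k‖) {n : ℕ}
    (hn : 0 < n) : Summable fun m => ‖floquetCoeff a n m‖ := by
  obtain ⟨B, hB⟩ := exists_norm_floquetCoeff_le ha hn
  rw [← summable_nat_add_iff 1]
  refine Summable.of_nonneg_of_le (fun _ => norm_nonneg _)
    (fun m => norm_floquetCoeff_succ_le ha hn fun j _ => hB j) (Summable.mul_right _ ?_)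
  have := (summable_nat_add_iff 1).2 (Real.summable_one_div_nat_pow.2 one_lt_two)
  simpa using this

lemma summable_norm_floquetCoeff_mul_sq {a : ℕ → ℂ} (ha : Summable fun k => ‖a k‖) {n : ℕ}
    (hn : 0 < n) : Summable fun m : ℕ => ‖floquetCoeff a n m‖ * (1 + n * (m : ℝ)) ^ 2 := by
  have hc := summable_norm_floquetCoeff ha hn
  rw [← summable_nat_add_iff 1]
  refine Summable.of_nonneg_of_le (fun _ => by positivity) (fun m => ?_)
    (((summable_norm_sum_mul_antidiagonal_of_summable_norm hc ha).mul_left ((n : ℝ) ^ 2)).add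
      ((summable_nat_add_iff 1).2 hc))
  have h := floquetCoeff_recurrence a hn m
  have h2 : floquetCoeff a n (m + 1) * (1 + n * ((m : ℂ) + 1)) ^ 2 =
      -((n : ℂ) ^ 2 * ∑ p ∈ Finset.HasAntidiagonal.antidiagonal m, floquetCoeff a n p.1 * a p.2) +
        floquetCoeff a n (m + 1) := by
    rw [← h]; ring
  have h3 := congrArg norm h2
  have h4 : ‖(1 + n * ((m : ℂ) + 1))‖ = 1 + n * ((m : ℝ) + 1) := by
    have : (1 + n * ((m : ℂ) + 1)) = ((1 + n * ((m : ℝ) + 1) : ℝ) : ℂ) := by push_cast; rfl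
    rw [this, Complex.norm_real, Real.norm_of_nonneg (by positivity)]
  rw [norm_mul, norm_pow, h4] at h3
  push_cast
  rw [h3]
  refine (norm_add_le _ _).trans ?_
  simp

lemma norm_exp_I_mul_ofReal (w x : ℝ) : ‖Complex.exp (Complex.I * w * x)‖ = 1 := by
  rw [mul_assoc, mul_comm, ← Complex.ofReal_mul, Complex.norm_exp_ofReal_mul_I]

lemma hasDerivAt_tsum_exp {b : ℕ → ℂ} {w : ℕ → ℝ} (hb : Summable fun m => ‖b m‖)
    (hbw : Summable fun m => ‖b m‖ * |w m|) (x : ℝ) :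
    HasDerivAt (fun x : ℝ => ∑' m, b m * Complex.exp (Complex.I * w m * x))
      (∑' m, (b m * (Complex.I * w m)) * Complex.exp (Complex.I * w m * x)) x := by
  refine hasDerivAt_tsum (𝕜 := ℝ) (F := ℂ) (y₀ := 0)
    (g := fun m (x : ℝ) => b m * Complex.exp (Complex.I * w m * x))
    (g' := fun m (x : ℝ) => (b m * (Complex.I * w m)) * Complex.exp (Complex.I * w m * x))
    hbw (fun m y => ?_) (fun m y => ?_) ?_ x
  · refine ((((hasDerivAt_id (y : ℂ)).const_mul (Complex.I * w m)).cexp.const_mul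
      (b m)).comp_ofReal).congr_deriv ?_
    simp only [id_eq, mul_one]
    ring
  · rw [norm_mul, norm_exp_I_mul_ofReal]; simp
  · exact Summable.of_norm (by simpa using hb)

lemma tsum_exp_ne_zero {b : ℕ → ℂ} (hb : Summable fun m => ‖b m‖) (hb0 : b 0 ≠ 0) {n : ℕ}
    (hn : 0 < n) :
    ∃ x : ℝ, ∑' m : ℕ, b m * Complex.exp (Complex.I * (1 + n * (m : ℝ) : ℝ) * x) ≠ 0 := by
  by_contra! h
  have hsum : ∀ x : ℝ,
      HasSum (fun m : ℕ => b m * Complex.exp (Complex.I * (n * (m : ℝ) : ℝ) * x)) 0 := by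
    intro x
    have hs : Summable fun m : ℕ => b m * Complex.exp (Complex.I * (n * (m : ℝ) : ℝ) * x) :=
      Summable.of_norm (by simpa only [norm_mul, norm_exp_I_mul_ofReal, mul_one] using hb)
    have h0 := h x
    have hfac : ∀ m : ℕ, b m * Complex.exp (Complex.I * (1 + n * (m : ℝ) : ℝ) * x) =
        Complex.exp (Complex.I * x) *
          (b m * Complex.exp (Complex.I * (n * (m : ℝ) : ℝ) * x)) := by
      intro m
      rw [mul_left_comm, ← Complex.exp_add]
      push_cast; ring_nf
    simp_rw [hfac] at h0
    rw [tsum_mul_left] at h0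
    rw [← (mul_eq_zero.1 h0).resolve_left (Complex.exp_ne_zero _)]
    exact hs.hasSum
  have hint := intervalIntegral.hasSum_integral_of_dominated_convergence
    (μ := MeasureTheory.volume) (a := 0) (b := 2 * Real.pi) (f := fun _ => (0 : ℂ))
    (F := fun (m : ℕ) (x : ℝ) => b m * Complex.exp (Complex.I * (n * (m : ℝ) : ℝ) * x))
    (fun m _ => ‖b m‖)
    (fun m => (by fun_prop : Continuous _).aestronglyMeasurable)
    (fun m => .of_forall fun x _ => by simp only [norm_mul, norm_exp_I_mul_ofReal, mul_one]; rfl)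
    (.of_forall fun _ _ => hb) (by simp)
    (.of_forall fun x _ => hsum x)
  have hzero : ∀ m : ℕ, m ≠ 0 →
      ∫ x in (0 : ℝ)..2 * Real.pi, b m * Complex.exp (Complex.I * (n * (m : ℝ) : ℝ) * x) = 0 := by
    intro m hm
    have hne : Complex.I * ((n * (m : ℝ) : ℝ) : ℂ) ≠ 0 := by
      simp [hm, hn.ne']
    rw [intervalIntegral.integral_const_mul, integral_exp_mul_complex hne]
    have : Complex.exp (Complex.I * ((n * (m : ℝ) : ℝ) : ℂ) * ((2 * Real.pi : ℝ) : ℂ)) = 1 := by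
      rw [Complex.exp_eq_one_iff]
      exact ⟨n * m, by push_cast; ring⟩
    rw [this]; simp
  have h1 := hint.unique (hasSum_single 0 hzero)
  simp [hb0, Real.pi_ne_zero] at h1

lemma IsHillSolution.wronskian_eq {q : ℝ → ℂ} {z : ℂ} {f g : ℝ → ℂ} (hf : IsHillSolution q z f)
    (hg : IsHillSolution q z g) (x : ℝ) :
    f x * deriv g x - deriv f x * g x = f 0 * deriv g 0 - deriv f 0 * g 0 := by
  obtain ⟨hf, hf', hfe⟩ := hf
  obtain ⟨hg, hg', hge⟩ := hg
  have hd : ∀ x, HasDerivAt (fun x => f x * deriv g x - deriv f x * g x) 0 x := by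
    intro x
    refine (((hf x).hasDerivAt.mul (hg' x).hasDerivAt).sub
      ((hf' x).hasDerivAt.mul (hg x).hasDerivAt)).congr_deriv ?_
    linear_combination g x * hfe x - f x * hge x
  exact is_const_of_deriv_eq_zero (fun x => (hd x).differentiableAt) (fun x => (hd x).deriv) x 0

/-- The monodromy matrix has determinant one, so a nontrivial periodic solution forces its trace
to be two. -/
lemma IsHillSolution.discriminant_eq_two {q : ℝ → ℂ} {z : ℂ} {c s y : ℝ → ℂ} {T : ℝ}
    (hc : IsHillSolution q z c) (hc0 : c 0 = 1) (hc0' : deriv c 0 = 0)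
    (hs : IsHillSolution q z s) (hs0 : s 0 = 0) (hs0' : deriv s 0 = 1)
    (hy : IsHillSolution q z y) (hyT : Function.Periodic y T) (hy0 : ∃ x, y x ≠ 0) :
    c T + deriv s T = 2 := by
  have hcs := hc.wronskian_eq hs
  have hys := hy.wronskian_eq hs
  have hcy := hc.wronskian_eq hy
  simp only [hc0, hc0', hs0, hs0', one_mul, mul_one, mul_zero, zero_mul, sub_zero] at hcs hys hcy
  have hT : y T = y 0 := by simpa using hyT 0
  have hT' : deriv y T = deriv y 0 := by
    have := deriv_comp_add_const y T 0
    rw [zero_add, hyT.funext] at this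
    exact this.symm
  have h1 := hcs T
  have h2 := hys T
  have h3 := hcy T
  rw [hT, hT'] at h2 h3
  have hα : y 0 * (c T + deriv s T - 2) = 0 := by
    linear_combination y 0 * h1 - (c T - 1) * h2 - s T * h3
  have hβ : deriv y 0 * (c T + deriv s T - 2) = 0 := by
    linear_combination deriv y 0 * h1 - deriv c T * h2 - (deriv s T - 1) * h3
  by_contra hne
  have hne' : c T + deriv s T - 2 ≠ 0 := fun h => hne (sub_eq_zero.1 h)
  have hα0 := (mul_eq_zero.1 hα).resolve_right hne'
  have hβ0 := (mul_eq_zero.1 hβ).resolve_right hne'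
  obtain ⟨x, hx⟩ := hy0
  refine hx ?_
  have e2 := hys x
  have e3 := hcy x
  rw [hα0] at e2
  rw [hβ0] at e3
  linear_combination -y x * hcs x + c x * e2 + s x * e3

/-- The solution of the Hill equation with potential `n² ∑ a k * exp (I * (k + 1) * n * x)` at
spectral parameter `1` that extends the free solution `exp (I * x)`. -/
def floquetSolution (a : ℕ → ℂ) (n : ℕ) (x : ℝ) : ℂ :=
  ∑' m : ℕ, floquetCoeff a n m * Complex.exp (Complex.I * (1 + n * (m : ℝ) : ℝ) * x)

lemma floquetSolution_periodic (a : ℕ → ℂ) (n : ℕ) :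
    Function.Periodic (floquetSolution a n) (2 * Real.pi) := by
  intro x
  refine tsum_congr fun m => ?_
  congr 1
  rw [Complex.exp_eq_exp_iff_exists_int]
  exact ⟨1 + n * m, by push_cast; ring⟩

lemma isHillSolution_floquetSolution {a : ℕ → ℂ} (ha : Summable fun k => ‖a k‖) {n : ℕ}
    (hn : 0 < n) {q : ℝ → ℂ}
    (hq : ∀ x : ℝ, q x =
      (n : ℂ) ^ 2 * ∑' k : ℕ, a k * Complex.exp (Complex.I * (((k : ℂ) + 1) * n) * (x : ℂ))) :
    IsHillSolution q 1 (floquetSolution a n) := by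
  have hc := summable_norm_floquetCoeff ha hn
  have hc2 := summable_norm_floquetCoeff_mul_sq ha hn
  have hw : ∀ m : ℕ, 1 ≤ 1 + n * (m : ℝ) := fun m => by
    have : 0 ≤ n * (m : ℝ) := by positivity
    linarith
  have hc1 : Summable fun m : ℕ => ‖floquetCoeff a n m‖ * |1 + n * (m : ℝ)| := by
    refine Summable.of_nonneg_of_le (fun _ => by positivity) (fun m => ?_) hc2
    have := hw m
    rw [abs_of_nonneg (by linarith)]
    gcongr
    nlinarith
  have hd := hasDerivAt_tsum_exp hc hc1
  have hd' := hasDerivAt_tsum_exp (w := fun m : ℕ => 1 + n * (m : ℝ))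
    (b := fun m : ℕ => floquetCoeff a n m * (Complex.I * (1 + n * (m : ℝ) : ℝ)))
    (by simpa only [norm_mul, Complex.norm_I, one_mul, Complex.norm_real, Real.norm_eq_abs]
      using hc1)
    (by simpa only [norm_mul, Complex.norm_I, one_mul, Complex.norm_real, Real.norm_eq_abs,
      mul_assoc, abs_mul_abs_self, ← sq, sq_abs] using hc2)
  have hderiv : deriv (floquetSolution a n) = _ := funext fun x => (hd x).deriv
  refine ⟨fun x => (hd x).differentiableAt, ?_, fun x => ?_⟩
  · rw [hderiv]
    exact fun x => (hd' x).differentiableAt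
  rw [hderiv, (hd' x).deriv, hq]
  have hsum : ∀ {b : ℕ → ℂ}, (Summable fun m => ‖b m‖) →
      Summable fun m : ℕ => ‖b m * Complex.exp (Complex.I * (1 + n * (m : ℝ) : ℝ) * x)‖ := by
    intro b hb
    simpa only [norm_mul, norm_exp_I_mul_ofReal, mul_one] using hb
  have ha' : Summable fun k : ℕ =>
      ‖a k * Complex.exp (Complex.I * (((k : ℂ) + 1) * n) * (x : ℂ))‖ := by
    refine ha.congr fun k => ?_
    have := norm_exp_I_mul_ofReal (((k : ℝ) + 1) * n) x
    push_cast at this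
    rw [norm_mul, this, mul_one]
  have hprod := tsum_mul_tsum_eq_tsum_sum_antidiagonal_of_summable_norm (hsum hc) ha'
  have hconv : ∀ m : ℕ, ∑ p ∈ Finset.HasAntidiagonal.antidiagonal m,
      floquetCoeff a n p.1 * Complex.exp (Complex.I * (1 + n * (p.1 : ℝ) : ℝ) * x) *
        (a p.2 * Complex.exp (Complex.I * (((p.2 : ℂ) + 1) * n) * (x : ℂ))) =
      (∑ p ∈ Finset.HasAntidiagonal.antidiagonal m, floquetCoeff a n p.1 * a p.2) *
        Complex.exp (Complex.I * (1 + n * ((m + 1 : ℕ) : ℝ) : ℝ) * x) := by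
    intro m
    rw [Finset.sum_mul]
    refine Finset.sum_congr rfl fun p hp => ?_
    rw [mul_mul_mul_comm, ← Complex.exp_add, ← Finset.HasAntidiagonal.mem_antidiagonal.1 hp]
    push_cast; ring_nf
  simp_rw [hconv] at hprod
  set e : ℕ → ℂ := fun m => Complex.exp (Complex.I * (1 + n * (m : ℝ) : ℝ) * x)
  have hS2 : Summable fun m : ℕ => floquetCoeff a n m * (Complex.I * (1 + n * (m : ℝ) : ℝ)) *
      (Complex.I * (1 + n * (m : ℝ) : ℝ)) * e m :=
    (hsum (b := fun m : ℕ => floquetCoeff a n m * (Complex.I * (1 + n * (m : ℝ) : ℝ)) *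
      (Complex.I * (1 + n * (m : ℝ) : ℝ))) (by simpa only [norm_mul, norm_pow, Complex.norm_I,
      one_mul, Complex.norm_real, Real.norm_eq_abs,
      mul_assoc, abs_mul_abs_self, ← sq, sq_abs] using hc2)).of_norm
  have hS0 : Summable fun m : ℕ => floquetCoeff a n m * e m := (hsum hc).of_norm
  have hkey : (∑' m : ℕ, floquetCoeff a n m * (Complex.I * (1 + n * (m : ℝ) : ℝ)) *
      (Complex.I * (1 + n * (m : ℝ) : ℝ)) * e m) + ∑' m, floquetCoeff a n m * e m =
      (n : ℂ) ^ 2 * ∑' m : ℕ,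
        (∑ p ∈ Finset.HasAntidiagonal.antidiagonal m, floquetCoeff a n p.1 * a p.2) * e (m + 1) := by
    rw [← hS2.tsum_add hS0, (hS2.add hS0).tsum_eq_zero_add, ← tsum_mul_left]
    have h0 : floquetCoeff a n 0 * (Complex.I * (1 + n * ((0 : ℕ) : ℝ) : ℝ)) *
        (Complex.I * (1 + n * ((0 : ℕ) : ℝ) : ℝ)) * e 0 + floquetCoeff a n 0 * e 0 = 0 := by
      push_cast
      linear_combination floquetCoeff a n 0 * e 0 * Complex.I_sq
    rw [h0, zero_add]
    refine tsum_congr fun m => ?_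
    push_cast
    linear_combination -e (m + 1) * floquetCoeff_recurrence a hn m +
      floquetCoeff a n (m + 1) * (1 + n * ((m : ℂ) + 1)) ^ 2 * e (m + 1) * Complex.I_sq
  change -(∑' m : ℕ, floquetCoeff a n m * (Complex.I * (1 + n * (m : ℝ) : ℝ)) *
      (Complex.I * (1 + n * (m : ℝ) : ℝ)) * e m) +
    (n : ℂ) ^ 2 * (∑' k : ℕ, a k * Complex.exp (Complex.I * (((k : ℂ) + 1) * n) * (x : ℂ))) *
      (∑' m, floquetCoeff a n m * e m) = 1 * ∑' m, floquetCoeff a n m * e m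
  linear_combination (n : ℂ) ^ 2 * hprod - hkey

/-- For `qₙ(x) = n² ∑_{k=1}^∞ a_k e^{iknx}` with `∑|a_k| < ∞` and `n ≥ 3`, the Floquet
discriminant at spectral parameter `1` satisfies `Δ(qₙ;1) = c(2π) + s'(2π) = 2`. -/
theorem discriminant_at_one_eq_two
    (a : ℕ → ℂ) (ha : Summable fun k => ‖a k‖)
    (n : ℕ) (hn : 3 ≤ n)
    (qn : ℝ → ℂ)
    (hq : ∀ x : ℝ, qn x =
      (n : ℂ) ^ 2 * ∑' k : ℕ, a k * Complex.exp (Complex.I * (((k : ℂ) + 1) * n) * (x : ℂ)))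
    (c s : ℝ → ℂ)
    (hc : IsHillSolution qn 1 c) (hc0 : c 0 = 1) (hc0' : deriv c 0 = 0)
    (hs : IsHillSolution qn 1 s) (hs0 : s 0 = 0) (hs0' : deriv s 0 = 1) :
    c (2 * Real.pi) + deriv s (2 * Real.pi) = 2 := by
  have hn' : 0 < n := by omega
  exact IsHillSolution.discriminant_eq_two hc hc0 hc0' hs hs0 hs0'
    (isHillSolution_floquetSolution ha hn' hq) (floquetSolution_periodic a n)
    (tsum_exp_ne_zero (summable_norm_floquetCoeff ha hn') (by simp [floquetCoeff]) hn')
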